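/- arXiv:2411.04718 — 3 statements merged into one kernel-verified Lean document; each statement's English description precedes it below -/
import Mathlib

section
/- Let n ∈ ℕ, let π be a permutation of {1,…,n}, let i < j be indices with π(i) < π(j), and let k, k' be indices with i < k < j, i < k' < j, and π(k) < π(k') < π(i). For an index m with i < m < j and π(m) < π(i), let C_{i,j,m} denote the set of 1324-copies (i₁,i₂,i₃,i₄) of π with i₂ = i, i₃ = m, and i₄ = j. Then |C_{i,j,k}| ≤ |C_{i,j,k'}|. -/
/-- A 1324-copy of `π`: indices `a < b < c < d` with `π a < π c < π b < π d`. -/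
abbrev IsCopy1324 {n : ℕ} (π : Equiv.Perm (Fin n)) (a b c d : Fin n) : Prop :=
  a < b ∧ b < c ∧ c < d ∧ π a < π c ∧ π c < π b ∧ π b < π d

/-- `C1324 π i j m` is the set of 1324-copies with the "3" at position `i`, the "2" at
position `m`, and the "4" at position `j`. -/
abbrev C1324 {n : ℕ} (π : Equiv.Perm (Fin n)) (i j m : Fin n) :
    Finset (Fin n × Fin n × Fin n × Fin n) :=
  Finset.univ.filter (fun q =>
    IsCopy1324 π q.1 q.2.1 q.2.2.1 q.2.2.2 ∧ q.2.1 = i ∧ q.2.2.1 = m ∧ q.2.2.2 = j)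

theorem monotone_in_value_of_2_for_1324 {n : ℕ} (π : Equiv.Perm (Fin n))
    (i j k k' : Fin n) (hij : i < j) (hval : π i < π j)
    (hik : i < k) (hkj : k < j) (hik' : i < k') (hk'j : k' < j)
    (hkk' : π k < π k') (hk'i : π k' < π i) :
    (C1324 π i j k).card ≤ (C1324 π i j k').card := by
  refine Finset.card_le_card_of_injOn (fun q => (q.1, i, k', j)) ?_ ?_
  · rintro ⟨a, b, c, d⟩ hq
    rw [Finset.mem_coe, Finset.mem_filter_univ] at hq
    obtain ⟨⟨hab, -, -, hac, -, -⟩, rfl, rfl, rfl⟩ := hq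
    rw [Finset.mem_coe, Finset.mem_filter_univ]
    exact ⟨⟨hab, hik', hk'j, hac.trans hkk', hk'i, hval⟩, rfl, rfl, rfl⟩
  · rintro ⟨a, b, c, d⟩ hq ⟨a', b', c', d'⟩ hq' h
    simp only [Finset.mem_coe, Finset.mem_filter_univ] at hq hq'
    obtain ⟨-, rfl, rfl, rfl⟩ := hq
    obtain ⟨-, rfl, rfl, rfl⟩ := hq'
    obtain rfl : a = a' := (Prod.mk.inj h).1
    rfl
end

section
/- Let n ∈ ℕ, let π be a permutation of {1,…,n}, let i < j be indices with π(j) > π(i), and let k, k' be indices with k > j, k' > j, and π(k) < π(k') < π(i). For an index m > j with π(m) < π(i), let D_{i,j,m} denote the set of 1342-copies (i₁,i₂,i₃,i₄) of π with i₂ = i, i₃ = j, and i₄ = m. Then |D_{i,j,k}| ≤ |D_{i,j,k'}| (the counts are non-decreasing in the value of the '2'). -/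
/-- A 1342-copy of `π`: indices `a < b < c < d` with `π a < π d < π b < π c`. -/
abbrev IsCopy1342 {n : ℕ} (π : Equiv.Perm (Fin n)) (a b c d : Fin n) : Prop :=
  a < b ∧ b < c ∧ c < d ∧ π a < π d ∧ π d < π b ∧ π b < π c

/-- `D1342 π i j m` is the set of 1342-copies with the "3" at position `i`, the "4" at
position `j`, and the "2" at position `m`. -/
abbrev D1342 {n : ℕ} (π : Equiv.Perm (Fin n)) (i j m : Fin n) :
    Finset (Fin n × Fin n × Fin n × Fin n) :=
  Finset.univ.filter (fun q =>
    IsCopy1342 π q.1 q.2.1 q.2.2.1 q.2.2.2 ∧ q.2.1 = i ∧ q.2.2.1 = j ∧ q.2.2.2 = m)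

theorem monotone_in_value_of_2_for_1342 {n : ℕ} (π : Equiv.Perm (Fin n))
    (i j k k' : Fin n) (hij : i < j) (hval : π i < π j)
    (hjk : j < k) (hjk' : j < k')
    (hkk' : π k < π k') (hk'i : π k' < π i) :
    (D1342 π i j k).card ≤ (D1342 π i j k').card := by
  refine Finset.card_le_card_of_injOn (fun q => (q.1, i, j, k')) ?_ ?_
  · rintro ⟨a, b, c, d⟩ hq
    simp only [Finset.coe_filter, Finset.mem_univ, true_and, Set.mem_ofPred_eq,
      and_true] at hq ⊢
    obtain ⟨⟨hab, -, -, had, -, -⟩, rfl, rfl, rfl⟩ := hq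
    exact ⟨hab, hij, hjk', had.trans hkk', hk'i, hval⟩
  · rintro ⟨a, b, c, d⟩ hq ⟨a', b', c', d'⟩ hq' h
    simp only [Finset.coe_filter, Finset.mem_univ, true_and, Set.mem_ofPred_eq] at hq hq'
    obtain ⟨-, rfl, rfl, rfl⟩ := hq
    obtain ⟨-, rfl, rfl, rfl⟩ := hq'
    simp_all
end

section
/- Let n ∈ ℕ, let π be a permutation of {1,…,n}, let i and k be indices with k > i and π(k) < π(i), and let m < m' < i be indices with π(m) > π(i) and π(m') > π(i). For an index p < i with π(p) > π(i), let F_{i,k,p} denote the set of 1432-copies (i₁,i₂,i₃,i₄) of π with i₂ = p, i₃ = i, and i₄ = k. Then |F_{i,k,m}| ≤ |F_{i,k,m'}| (the counts are non-decreasing in the position of the '4'). -/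
/-- A 1432-copy of `π`: indices `a < b < c < d` with `π a < π d < π c < π b`. -/
abbrev IsCopy1432 {n : ℕ} (π : Equiv.Perm (Fin n)) (a b c d : Fin n) : Prop :=
  a < b ∧ b < c ∧ c < d ∧ π a < π d ∧ π d < π c ∧ π c < π b

/-- `F1432 π i k p` is the set of 1432-copies with the "4" at position `p`, the "3" at
position `i`, and the "2" at position `k`. -/
abbrev F1432 {n : ℕ} (π : Equiv.Perm (Fin n)) (i k p : Fin n) :
    Finset (Fin n × Fin n × Fin n × Fin n) :=
  Finset.univ.filter (fun q =>
    IsCopy1432 π q.1 q.2.1 q.2.2.1 q.2.2.2 ∧ q.2.1 = p ∧ q.2.2.1 = i ∧ q.2.2.2 = k)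

theorem monotone_in_position_of_4_for_1432 {n : ℕ} (π : Equiv.Perm (Fin n))
    (i k m m' : Fin n) (hik : i < k) (hval : π k < π i)
    (hmm' : m < m') (hm'i : m' < i)
    (hm : π i < π m) (hm' : π i < π m') :
    (F1432 π i k m).card ≤ (F1432 π i k m').card := by
  refine Finset.card_le_card_of_injOn (fun q => (q.1, m', q.2.2)) ?_ ?_
  · rintro ⟨a, b, c, d⟩ hq
    simp only [Finset.coe_filter, Finset.mem_univ, true_and, Set.mem_ofPred_eq] at hq ⊢
    obtain ⟨⟨hab, -, hcd, had, hdc, -⟩, rfl, rfl, rfl⟩ := hq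
    exact ⟨⟨hab.trans hmm', hm'i, hcd, had, hdc, hm'⟩, rfl, rfl⟩
  · rintro ⟨a, b, c, d⟩ hq ⟨a', b', c', d'⟩ hq' h
    simp only [Finset.coe_filter, Finset.mem_univ, true_and, Set.mem_ofPred_eq] at hq hq'
    simp only [Prod.mk.injEq, true_and] at h ⊢
    exact ⟨h.1, hq.2.1.trans hq'.2.1.symm, h.2⟩
end
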